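/- Let f : ℝ → ℝ be a nonnegative measurable probability density with respect to Lebesgue measure (∫ f = 1), with finite mean μ = ∫ t f(t) dt and finite variance σ² = ∫ (t − μ)² f(t) dt, and suppose f log f is Lebesgue integrable. Then σ² ≥ (1/(2πe)) · exp( 2 h(f) ), where h(f) = -∫ f(t) log f(t) dt. -/

import Mathlib

open MeasureTheory Real

/-- The pointwise form of Gibbs' inequality. -/
lemma mul_log_add_sub_le_mul_log {a b : ℝ} (ha : 0 ≤ a) (hb : 0 < b) :
    a * Real.log b + (a - b) ≤ a * Real.log a := by
  rcases ha.eq_or_lt with rfl | ha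
  · simp [hb.le]
  · have h := Real.log_le_sub_one_of_pos (div_pos hb ha)
    rw [Real.log_div hb.ne' ha.ne'] at h
    have h' := mul_le_mul_of_nonneg_left h ha.le
    have hab : a * (b / a - 1) = b - a := by field_simp
    rw [hab] at h'
    linarith

lemma log_gaussianPDFReal (m : ℝ) {v : NNReal} (hv : v ≠ 0) (t : ℝ) :
    Real.log (ProbabilityTheory.gaussianPDFReal m v t) =
      -(Real.log (2 * Real.pi * v) / 2) - (t - m) ^ 2 / (2 * v) := by
  have hv' : (0 : ℝ) < v := by positivity
  have hpos : 0 < 2 * Real.pi * (v : ℝ) := by positivity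
  rw [ProbabilityTheory.gaussianPDFReal, Real.log_mul (by positivity) (Real.exp_ne_zero _),
    Real.log_inv, Real.log_sqrt hpos.le, Real.log_exp]
  ring

/-- A probability density has positive second moment about every point. -/
lemma integral_sub_sq_mul_pos {f : ℝ → ℝ} (hf0 : ∀ t, 0 ≤ f t) (hf1 : ∫ t, f t = 1) (m : ℝ)
    (hint : Integrable (fun t => (t - m) ^ 2 * f t)) :
    0 < ∫ t, (t - m) ^ 2 * f t := by
  have hnn : 0 ≤ fun t => (t - m) ^ 2 * f t := fun t => mul_nonneg (sq_nonneg _) (hf0 t)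
  refine (integral_nonneg hnn).lt_of_ne fun h => ?_
  have hae := (integral_eq_zero_iff_of_nonneg hnn hint).1 h.symm
  have hf : f =ᵐ[volume] 0 := by
    filter_upwards [hae, Measure.ae_ne volume m] with t ht htm
    exact (mul_eq_zero.1 ht).resolve_left (pow_ne_zero 2 (sub_ne_zero.2 htm))
  rw [integral_congr_ae hf] at hf1
  simp at hf1

/-- Among densities with given second moment about `m`, the Gaussian maximizes the entropy. -/
lemma neg_integral_mul_log_le {f : ℝ → ℝ} (hf0 : ∀ t, 0 ≤ f t) (hf1 : ∫ t, f t = 1) (m : ℝ)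
    (hint : Integrable (fun t => (t - m) ^ 2 * f t))
    (hlog : Integrable (fun t => f t * Real.log (f t))) :
    -∫ t, f t * Real.log (f t) ≤
      (Real.log (2 * Real.pi * ∫ t, (t - m) ^ 2 * f t) + 1) / 2 := by
  have hpos := integral_sub_sq_mul_pos hf0 hf1 m hint
  obtain ⟨v, hv⟩ : ∃ v : NNReal, (v : ℝ) = ∫ t, (t - m) ^ 2 * f t := ⟨⟨_, hpos.le⟩, rfl⟩
  rw [← hv] at hpos ⊢
  have hv0 : v ≠ 0 := by exact_mod_cast hpos.ne'
  have hfi : Integrable f := by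
    by_contra h
    simp [integral_undef h] at hf1
  have hgi := ProbabilityTheory.integrable_gaussianPDFReal m v
  have hA : Integrable fun t => (1 - Real.log (2 * Real.pi * v) / 2) * f t := hfi.const_mul _
  have hB : Integrable fun t => (2 * (v : ℝ))⁻¹ * ((t - m) ^ 2 * f t) := hint.const_mul _
  have hAB : Integrable fun t => (1 - Real.log (2 * Real.pi * v) / 2) * f t
      - (2 * (v : ℝ))⁻¹ * ((t - m) ^ 2 * f t) := hA.sub hB
  have hle : ∫ t, ((1 - Real.log (2 * Real.pi * v) / 2) * f t
      - (2 * (v : ℝ))⁻¹ * ((t - m) ^ 2 * f t) - ProbabilityTheory.gaussianPDFReal m v t)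
      ≤ ∫ t, f t * Real.log (f t) := by
    refine integral_mono (hAB.sub hgi) hlog fun t => ?_
    have h := mul_log_add_sub_le_mul_log (hf0 t)
      (ProbabilityTheory.gaussianPDFReal_pos m v t hv0)
    rw [log_gaussianPDFReal m hv0] at h
    refine le_trans (le_of_eq ?_) h
    ring
  rw [integral_sub hAB hgi, integral_sub hA hB, integral_const_mul, integral_const_mul,
    hf1, ← hv, ProbabilityTheory.integral_gaussianPDFReal_eq_one m hv0] at hle
  have hhalf : (2 * (v : ℝ))⁻¹ * v = 1 / 2 := by field_simp
  rw [hhalf] at hle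
  linarith

/-- The variance of a real density is at least `(1/(2πe)) · exp(2 h(f))` where `h(f)` is the
differential entropy. -/
theorem var_ge_entropy_exp_bound
    (f : ℝ → ℝ) (hfmeas : Measurable f) (hf0 : ∀ t, 0 ≤ f t)
    (hf1 : ∫ t, f t = 1)
    (μ σ2 : ℝ)
    (hμint : Integrable (fun t => t * f t)) (hμ : μ = ∫ t, t * f t)
    (hσint : Integrable (fun t => (t - μ) ^ 2 * f t))
    (hσ : σ2 = ∫ t, (t - μ) ^ 2 * f t)
    (hlog : Integrable (fun t => f t * Real.log (f t))) :
    (1 / (2 * Real.pi * Real.exp 1)) * Real.exp (2 * (-∫ t, f t * Real.log (f t))) ≤ σ2 := by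
  have hpos := integral_sub_sq_mul_pos hf0 hf1 μ hσint
  have h := neg_integral_mul_log_le hf0 hf1 μ hσint hlog
  rw [← hσ] at hpos h
  have hexp : Real.exp (2 * (-∫ t, f t * Real.log (f t))) ≤ 2 * Real.pi * σ2 * Real.exp 1 := by
    rw [← Real.exp_log (show 0 < 2 * Real.pi * σ2 by positivity), ← Real.exp_add,
      Real.exp_le_exp]
    linarith
  rw [one_div_mul_eq_div, div_le_iff₀ (by positivity)]
  linarith
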